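/- arXiv:2203.01647 — 3 statements merged into one kernel-verified Lean document; each statement's English description precedes it below -/
import Mathlib

section
/- Let (a_k)_{k≥0} be a non-negative real sequence, let α > 1, let ξ > 0, and define b_k = Σ_{j=0}^k a_j. Then for every k ≥ 0, Σ_{j=0}^k a_j/(ξ + b_j)^α ≤ ξ^{1−α}/(α − 1). -/
open Finset

/-- Tangent-line bound for the convex function `t ↦ t ^ (1 - α)`, taken at `y`. -/
theorem sub_div_rpow_le_rpow_sub_rpow_div {α x y : ℝ} (hα : 1 < α) (hx : 0 < x) (hy : 0 < y) :
    (y - x) / y ^ α ≤ (x ^ (1 - α) - y ^ (1 - α)) / (α - 1) := by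
  have hlog : Real.log (x / y) ≤ x / y - 1 := Real.log_le_sub_one_of_pos (div_pos hx hy)
  have hexp : 1 + (α - 1) * (1 - x / y) ≤ (x / y) ^ (1 - α) := by
    rw [Real.rpow_def_of_pos (div_pos hx hy)]
    nlinarith [Real.add_one_le_exp (Real.log (x / y) * (1 - α))]
  rw [Real.div_rpow hx.le hy.le, le_div_iff₀ (Real.rpow_pos_of_pos hy _)] at hexp
  have hpow : (y - x) / y ^ α = (1 - x / y) * y ^ (1 - α) := by
    rw [Real.rpow_sub hy, Real.rpow_one]
    have := (Real.rpow_pos_of_pos hy α).ne'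
    field_simp
  rw [hpow, le_div_iff₀ (sub_pos.2 hα)]
  linarith

/-- Telescoped form of the tangent-line bound along the partial sums of `a`. -/
theorem sum_div_rpow_partial_sum_le {a : ℕ → ℝ} (ha : ∀ k, 0 ≤ a k) {α ξ : ℝ}
    (hα : 1 < α) (hξ : 0 < ξ) (n : ℕ) :
    ∑ j ∈ range n, a j / (ξ + ∑ i ∈ range (j + 1), a i) ^ α ≤
      (ξ ^ (1 - α) - (ξ + ∑ i ∈ range n, a i) ^ (1 - α)) / (α - 1) := by
  have hpos (m : ℕ) : 0 < ξ + ∑ i ∈ range m, a i :=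
    add_pos_of_pos_of_nonneg hξ (sum_nonneg fun i _ => ha i)
  induction n with
  | zero => simp
  | succ n ih =>
    have h := sub_div_rpow_le_rpow_sub_rpow_div hα (hpos n) (hpos (n + 1))
    have hdiff : ξ + ∑ i ∈ range (n + 1), a i - (ξ + ∑ i ∈ range n, a i) = a n := by
      rw [sum_range_succ]
      ring
    rw [hdiff] at h
    rw [sum_range_succ]
    refine (add_le_add ih h).trans_eq ?_
    ring

/-- Consequence (alphasup1maj) of Lemma 3.1 of the paper: for `α > 1`,
`∑_{j=0}^k a j / (ξ + b j) ^ α ≤ ξ^(1-α)/(α-1)` uniformly in `k`. -/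
theorem series_bound_alpha_gt_one (a : ℕ → ℝ) (ha : ∀ k, 0 ≤ a k)
    (α ξ : ℝ) (hα : 1 < α) (hξ : 0 < ξ) (k : ℕ) :
    ∑ j ∈ Finset.range (k + 1),
        a j / (ξ + ∑ i ∈ Finset.range (j + 1), a i) ^ α ≤
      ξ ^ (1 - α) / (α - 1) := by
  refine (sum_div_rpow_partial_sum_le ha hα hξ (k + 1)).trans ?_
  have hpos : 0 ≤ ξ + ∑ i ∈ range (k + 1), a i :=
    add_nonneg hξ.le (sum_nonneg fun i _ => ha i)
  exact div_le_div_of_nonneg_right (sub_le_self _ (Real.rpow_nonneg hpos _)) (sub_pos.2 hα).le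
end

section
/- Sharpness of Theorem 3.2: for each μ ∈ (0,1), each η ∈ (0,1] and each ς ∈ (0,1], there exists a function f : ℝ → ℝ which is continuously differentiable, whose derivative is Lipschitz continuous, and which is bounded below, together with a sequence (x_k)_{k≥0} with x₀ = 0, such that, writing g_k = f'(x_k) and w_k = (ς + Σ_{ℓ=0}^k g_ℓ²)^μ, one has g₀ = −2, g_k = −1/k^{1/2+η} for all k ≥ 1, and x_{k+1} = x_k + |g_k|/w_k for all k ≥ 0. In particular, |f'(x_k)| = k^{−(1/2+η)} for k ≥ 1, so the rate O(1/√(k+1)) for the gradient norms along ASTR1 with Adagrad-like scaling (B_k = 0, ϑ = θ = 1) is essentially sharp. -/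
open Finset

/-- The supremum of a square-summable family of tents of slope `L` whose centres are so far apart
that no tent covers the centre of another one. -/
theorem exists_lipschitz_integrable_interpolation {a x : ℕ → ℝ} {L : ℝ} (hL : 0 < L)
    (ha : ∀ k, 0 ≤ a k) (hbdd : BddAbove (Set.range a)) (hsum : Summable fun k => a k ^ 2)
    (hsep : ∀ j k, j ≠ k → a k ≤ L * |x j - x k|) :
    ∃ u : ℝ → ℝ, (∀ s t, |u s - u t| ≤ L * |s - t|) ∧ MeasureTheory.Integrable u ∧
      ∀ k, u (x k) = a k := by
  obtain ⟨M, hM⟩ := hbdd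
  have haM : ∀ k, a k ≤ M := fun k => hM ⟨k, rfl⟩
  set T : ℕ → ℝ → ℝ := fun k t => max 0 (a k - L * |t - x k|) with hT
  have hTa : ∀ k t, T k t ≤ a k := fun k t =>
    max_le (ha k) (by have := mul_nonneg hL.le (abs_nonneg (t - x k)); linarith)
  have hT0 : ∀ k t, 0 ≤ T k t := fun k t => le_max_left _ _
  have hTbdd : ∀ t, BddAbove (Set.range fun k => T k t) := fun t =>
    ⟨M, by rintro _ ⟨k, rfl⟩; exact (hTa k t).trans (haM k)⟩
  set u : ℝ → ℝ := fun t => ⨆ k, T k t with hu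
  have hle : ∀ s t, u s ≤ u t + L * |s - t| := by
    intro s t
    refine ciSup_le fun k => ?_
    have h1 : T k t ≤ u t := le_ciSup (hTbdd t) k
    have h2 : |t - x k| ≤ |s - t| + |s - x k| := by
      have := abs_sub_le t s (x k)
      rwa [abs_sub_comm t s] at this
    have h3 := mul_le_mul_of_nonneg_left h2 hL.le
    have h4 : a k - L * |t - x k| ≤ T k t := le_max_right _ _
    have h5 := hT0 k t
    have h6 := mul_nonneg hL.le (abs_nonneg (s - t))
    exact max_le (by linarith) (by linarith)
  have hlip : ∀ s t, |u s - u t| ≤ L * |s - t| := by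
    intro s t
    have h1 := hle s t
    have h2 := hle t s
    rw [abs_sub_comm t s] at h2
    exact abs_sub_le_iff.2 ⟨by linarith, by linarith⟩
  have hu0 : ∀ t, 0 ≤ u t := fun t => Real.iSup_nonneg fun k => hT0 k t
  have hcont : Continuous u :=
    (LipschitzWith.of_dist_le_mul (K := ⟨L, hL.le⟩) fun s t => hlip s t).continuous
  refine ⟨u, hlip, ⟨hcont.aestronglyMeasurable, ?_⟩, fun j => ?_⟩
  · have hsup : ∀ t, ENNReal.ofReal (u t) ≤ ∑' k, ENNReal.ofReal (T k t) := by
      intro t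
      by_contra! h
      have hlt := (ENNReal.lt_ofReal_iff_toReal_lt h.ne_top).1 h
      obtain ⟨k, hk⟩ := exists_lt_of_lt_ciSup hlt
      exact absurd ((ENNReal.lt_ofReal_iff_toReal_lt h.ne_top).2 hk)
        (ENNReal.le_tsum (f := fun k => ENNReal.ofReal (T k t)) k).not_gt
    have htent : ∀ k, ∫⁻ t, ENNReal.ofReal (T k t) ≤ ENNReal.ofReal (2 / L * a k ^ 2) := by
      intro k
      calc ∫⁻ t, ENNReal.ofReal (T k t)
          ≤ ∫⁻ t, (Set.Icc (x k - a k / L) (x k + a k / L)).indicator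
              (fun _ => ENNReal.ofReal (a k)) t := by
            refine MeasureTheory.lintegral_mono fun t => ?_
            by_cases ht : t ∈ Set.Icc (x k - a k / L) (x k + a k / L)
            · simpa [ht] using ENNReal.ofReal_le_ofReal (hTa k t)
            · have h1 : a k / L < |t - x k| := by
                by_contra! h
                have := abs_le.1 h
                exact ht ⟨by linarith, by linarith⟩
              have h2 : a k < L * |t - x k| := by
                rwa [div_lt_iff₀' hL] at h1
              have h3 : T k t = 0 := max_eq_left (by linarith)
              simp [h3]
        _ = ENNReal.ofReal (2 / L * a k ^ 2) := by
            rw [MeasureTheory.lintegral_indicator_const measurableSet_Icc, Real.volume_Icc,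
              ← ENNReal.ofReal_mul (ha k)]
            congr 1
            ring
    rw [MeasureTheory.hasFiniteIntegral_iff_ofReal (Filter.Eventually.of_forall hu0)]
    calc ∫⁻ t, ENNReal.ofReal (u t)
        ≤ ∫⁻ t, ∑' k, ENNReal.ofReal (T k t) := MeasureTheory.lintegral_mono hsup
      _ = ∑' k, ∫⁻ t, ENNReal.ofReal (T k t) := by
          refine MeasureTheory.lintegral_tsum fun k => ?_
          have : Measurable (T k) := Continuous.measurable (by fun_prop)
          exact this.ennreal_ofReal.aemeasurable
      _ ≤ ∑' k, ENNReal.ofReal (2 / L * a k ^ 2) := ENNReal.tsum_le_tsum htent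
      _ < ⊤ := (hsum.mul_left (2 / L)).tsum_ofReal_lt_top
  · have hj : T j (x j) = a j := by simp [hT, ha j]
    refine le_antisymm (ciSup_le fun k => ?_) (hj ▸ le_ciSup (hTbdd (x j)) j)
    by_cases hjk : j = k
    · subst hjk
      exact hj.le
    · have h1 := hsep j k hjk
      have h2 : T k (x j) = 0 := max_eq_left (by linarith)
      exact h2 ▸ ha j

/-- A primitive of `-u` for `u` continuous and integrable is bounded below. -/
theorem exists_contDiff_bddBelow_deriv_eq_neg {u : ℝ → ℝ} (hc : Continuous u)
    (hi : MeasureTheory.Integrable u) :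
    ∃ f : ℝ → ℝ, ContDiff ℝ 1 f ∧ (∀ t, deriv f t = -u t) ∧ ∃ m : ℝ, ∀ t, m ≤ f t := by
  have hn : Continuous fun s => -u s := hc.neg
  have hd : ∀ t, HasDerivAt (fun t => ∫ s in (0 : ℝ)..t, -u s) (-u t) t := fun t =>
    intervalIntegral.integral_hasDerivAt_right (hn.intervalIntegrable _ _)
      (hn.stronglyMeasurableAtFilter _ _) hn.continuousAt
  refine ⟨fun t => ∫ s in (0 : ℝ)..t, -u s, ?_, fun t => (hd t).deriv, -∫ s, ‖u s‖, fun t => ?_⟩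
  · rw [contDiff_one_iff_deriv]
    refine ⟨fun t => (hd t).differentiableAt, ?_⟩
    rw [show deriv (fun t => ∫ s in (0 : ℝ)..t, -u s) = fun t => -u t from
      funext fun t => (hd t).deriv]
    exact hn
  · have h1 : ‖∫ s in (0 : ℝ)..t, -u s‖ ≤ ∫ s in Set.uIoc 0 t, ‖-u s‖ :=
      intervalIntegral.norm_integral_le_integral_norm_uIoc
    have h2 : ∫ s in Set.uIoc 0 t, ‖-u s‖ ≤ ∫ s, ‖u s‖ := by
      simp only [norm_neg]
      exact MeasureTheory.setIntegral_le_integral hi.norm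
        (Filter.Eventually.of_forall fun s => norm_nonneg _)
    exact (abs_le.1 (h1.trans h2)).1

/-- Sharpness of Theorem 3.2 (Theorem 3.3 of the paper): for each `μ ∈ (0,1)`,
`η ∈ (0,1]` and `ς ∈ (0,1]`, there is a continuously differentiable function
`f : ℝ → ℝ`, bounded below and with Lipschitz continuous derivative, and a sequence
of iterates starting at `0` and following the ASTR1 step with Adagrad-like scaling
(`B_k = 0`, `ϑ = θ = 1`), whose gradients satisfy `g₀ = -2` and
`g_k = -1/k^(1/2+η)` for `k ≥ 1`. -/
theorem adagrad_rate_sharp (μ η ς : ℝ) (hμ : μ ∈ Set.Ioo (0 : ℝ) 1)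
    (hη : η ∈ Set.Ioc (0 : ℝ) 1) (hς : ς ∈ Set.Ioc (0 : ℝ) 1) :
    ∃ (f : ℝ → ℝ) (x : ℕ → ℝ),
      ContDiff ℝ 1 f ∧
      (∃ L : ℝ, 0 ≤ L ∧ ∀ a b : ℝ, |deriv f a - deriv f b| ≤ L * |a - b|) ∧
      (∃ flow : ℝ, ∀ t : ℝ, flow ≤ f t) ∧
      x 0 = 0 ∧
      deriv f (x 0) = -2 ∧
      (∀ k : ℕ, 1 ≤ k → deriv f (x k) = -1 / (k : ℝ) ^ ((1 : ℝ) / 2 + η)) ∧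
      (∀ k : ℕ, x (k + 1) = x k +
        |deriv f (x k)| /
          (ς + ∑ ℓ ∈ Finset.range (k + 1), (deriv f (x ℓ)) ^ 2) ^ μ) := by
  have hp : 0 < (1 : ℝ) / 2 + η := by linarith [hη.1]
  set p : ℝ := (1 : ℝ) / 2 + η with hp_def
  set a : ℕ → ℝ := fun k => if k = 0 then 2 else 1 / (k : ℝ) ^ p with ha_def
  have ha_zero : a 0 = 2 := by simp [ha_def]
  have ha_pos_index : ∀ k, 1 ≤ k → a k = 1 / (k : ℝ) ^ p := fun k hk => by
    simp [ha_def, Nat.one_le_iff_ne_zero.1 hk]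
  have ha : ∀ k, 0 ≤ a k := by
    intro k
    simp only [ha_def]
    split_ifs <;> positivity
  have ha_anti : Antitone a := by
    refine antitone_nat_of_succ_le fun k => ?_
    rw [ha_pos_index (k + 1) (by lia)]
    rcases Nat.eq_zero_or_pos k with rfl | hk
    · norm_num [ha_zero]
    · rw [ha_pos_index k hk]
      have hk' : (0 : ℝ) < k := by exact_mod_cast hk
      gcongr
      lia
  have hsum : Summable fun k => a k ^ 2 := by
    rw [← summable_nat_add_iff 1]
    have h := (summable_nat_add_iff 1).2
      (Real.summable_one_div_nat_rpow.2 (show 1 < p * 2 by rw [hp_def]; linarith [hη.1]))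
    refine h.congr fun k => ?_
    rw [ha_pos_index (k + 1) (by lia), Real.rpow_mul (by positivity), div_pow, one_pow,
      ← Real.rpow_natCast _ 2, Nat.cast_ofNat]
  set S : ℕ → ℝ := fun k => ς + ∑ ℓ ∈ Finset.range (k + 1), a ℓ ^ 2 with hS
  have hS_pos : ∀ k, 0 < S k := fun k =>
    add_pos_of_pos_of_nonneg hς.1 (Finset.sum_nonneg fun i _ => sq_nonneg _)
  have hS_le : ∀ k, S k ≤ ς + ∑' k, a k ^ 2 := fun k => by
    have := hsum.sum_le_tsum (Finset.range (k + 1)) fun i _ => sq_nonneg _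
    simpa [hS] using this
  set L : ℝ := (ς + ∑' k, a k ^ 2) ^ μ with hL_def
  have hw_pos : ∀ k, 0 < S k ^ μ := fun k => Real.rpow_pos_of_pos (hS_pos k) _
  have hw_le : ∀ k, S k ^ μ ≤ L := fun k =>
    Real.rpow_le_rpow (hS_pos k).le (hS_le k) hμ.1.le
  have hL : 0 < L := (hw_pos 0).trans_le (hw_le 0)
  set x : ℕ → ℝ := fun k => ∑ i ∈ Finset.range k, a i / S i ^ μ with hx_def
  have hx_succ : ∀ k, x (k + 1) = x k + a k / S k ^ μ := fun k => Finset.sum_range_succ _ _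
  have hx_mono : Monotone x := monotone_nat_of_le_succ fun k => by
    rw [hx_succ]
    exact le_add_of_nonneg_right (div_nonneg (ha k) (hw_pos k).le)
  have hsep_lt : ∀ i j, i < j → a i ≤ L * |x j - x i| := by
    intro i j hij
    have h1 : x (i + 1) ≤ x j := hx_mono hij
    rw [hx_succ] at h1
    calc a i = S i ^ μ * (a i / S i ^ μ) := (mul_div_cancel₀ _ (hw_pos i).ne').symm
      _ ≤ L * |x j - x i| :=
        mul_le_mul (hw_le i) (by linarith [le_abs_self (x j - x i)])
          (div_nonneg (ha i) (hw_pos i).le) hL.le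
  have hsep : ∀ j k, j ≠ k → a k ≤ L * |x j - x k| := by
    intro j k hjk
    rcases lt_or_gt_of_ne hjk with h | h
    · rw [abs_sub_comm]
      exact (ha_anti h.le).trans (hsep_lt j k h)
    · exact hsep_lt k j h
  obtain ⟨u, hlip, hint, hux⟩ := exists_lipschitz_integrable_interpolation hL ha
    ⟨a 0, by rintro _ ⟨k, rfl⟩; exact ha_anti k.zero_le⟩ hsum hsep
  have hcont : Continuous u :=
    (LipschitzWith.of_dist_le_mul (K := ⟨L, hL.le⟩) fun s t => hlip s t).continuous
  obtain ⟨f, hf, hdf, hbelow⟩ := exists_contDiff_bddBelow_deriv_eq_neg hcont hint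
  have hdx : ∀ k, deriv f (x k) = -a k := fun k => by rw [hdf, hux]
  refine ⟨f, x, hf, ⟨L, hL.le, fun s t => ?_⟩, hbelow, by simp [hx_def], ?_, fun k hk => ?_,
    fun k => ?_⟩
  · rw [hdf, hdf, neg_sub_neg, abs_sub_comm]
    exact hlip s t
  · rw [hdx, ha_zero]
  · rw [hdx, ha_pos_index k hk, neg_div]
  · simp only [hdx, abs_neg, neg_sq, abs_of_nonneg (ha k)]
    exact hx_succ k
end

section
/- Let (g_j)_{j≥0} and (v_j)_{j≥0} be real sequences with v_j > 0, let ς ∈ (0,1], and suppose that whenever v_{j+1} > v_j one has v_{j+1} ≤ |g_{j+1}|. Suppose there exists an index j_ς such that v_{j_ς} ≤ 2ς and min[g_j²/ς, g_j²/v_j] ≤ ς for all j ≥ j_ς. Then v_j ≤ 2ς for all j ≥ j_ς, and consequently min[g_j²/ς, g_j²/v_j] ≥ g_j²/(2ς) for all j ≥ j_ς. -/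
/-- Lemma 4.1 of the paper (for a fixed coordinate, with the boundary condition
`v jς ≤ 2ς` made explicit): if `v` can only increase up to `|g|`, and from index `jς`
on `min[g_j²/ς, g_j²/v_j] ≤ ς`, then `v_j ≤ 2ς` for all `j ≥ jς` and consequently
`min[g_j²/ς, g_j²/v_j] ≥ g_j²/(2ς)` for all `j ≥ jς`. -/
theorem divsprop (g v : ℕ → ℝ) (hv : ∀ j, 0 < v j) (ς : ℝ) (hς : ς ∈ Set.Ioc (0 : ℝ) 1)
    (hmono : ∀ j, v j < v (j + 1) → v (j + 1) ≤ |g (j + 1)|)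
    (jς : ℕ) (h0 : v jς ≤ 2 * ς)
    (hsmall : ∀ j, jς ≤ j → min ((g j) ^ 2 / ς) ((g j) ^ 2 / v j) ≤ ς) :
    (∀ j, jς ≤ j → v j ≤ 2 * ς) ∧
      (∀ j, jς ≤ j → (g j) ^ 2 / (2 * ς) ≤ min ((g j) ^ 2 / ς) ((g j) ^ 2 / v j)) := by
  have hpos : 0 < ς := hς.1
  have hbound : ∀ j, jς ≤ j → v j ≤ 2 * ς := by
    intro j hj
    induction j, hj using Nat.le_induction with
    | base => exact h0
    | succ j hj ih =>
      by_contra! hlt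
      have hsq : v (j + 1) ^ 2 ≤ g (j + 1) ^ 2 := by
        rw [← sq_abs (g (j + 1))]
        exact pow_le_pow_left₀ (hv _).le (hmono j (ih.trans_lt hlt)) 2
      rcases min_le_iff.mp (hsmall (j + 1) (by lia)) with h | h
      · rw [div_le_iff₀ hpos] at h
        nlinarith
      · rw [div_le_iff₀ (hv _)] at h
        nlinarith
  refine ⟨hbound, fun j hj => le_min ?_ ?_⟩
  · exact div_le_div_of_nonneg_left (sq_nonneg _) hpos (by linarith)
  · exact div_le_div_of_nonneg_left (sq_nonneg _) (hv j) (hbound j hj)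
end
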